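/- arXiv:1510.01722 — 7 statements merged into one kernel-verified Lean document; each statement's English description precedes it below -/
import Mathlib

section
/- Let 𝔽 be a field, n a positive integer, and let A, B, M be n×n matrices over 𝔽 with A^n = a·I and B^n = b·I for scalars a, b satisfying a·b ≠ 1. If the Stein displacement Δ_{A,B}[M] = M − A·M·B equals Σ_{j=1}^{r} g_j·h_j^T for vectors g_1,…,g_r, h_1,…,h_r ∈ 𝔽^n, then M = (1 − a·b)^{-1} · Σ_{j=1}^{r} krylov(A, g_j) · krylov(B^T, h_j)^T. -/
open Matrix BigOperators

noncomputable section

/-- The `f`-unit-circulant matrix `Z_f = [e2, e3, ..., en, f*e1]`: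
`(Z_f)_{ij} = 1` if `i = j+1`, `f` if `(i,j) = (1,n)` (1-indexed), and `0` otherwise. -/
def Zunit (R : Type*) [CommRing R] (n : ℕ) (f : R) : Matrix (Fin n) (Fin n) R :=
  Matrix.of fun i j => if (i : ℕ) = (j : ℕ) + 1 then 1
    else if (i : ℕ) = 0 ∧ (j : ℕ) = n - 1 then f else 0

/-- `krylov A v = [v, Av, A²v, ..., A^{n−1}v]`, whose `j`-th column (0-indexed) is `A^j v`. -/
def krylov {R : Type*} [CommRing R] {n : ℕ} (A : Matrix (Fin n) (Fin n) R)
    (v : Fin n → R) : Matrix (Fin n) (Fin n) R :=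
  Matrix.of fun i j => (A ^ (j : ℕ)).mulVec v i

/-- The `f`-circulant matrix `Z_f(v) = krylov(Z_f, v)`. -/
def Zcirc (R : Type*) [CommRing R] (n : ℕ) (f : R) (v : Fin n → R) :
    Matrix (Fin n) (Fin n) R :=
  krylov (Zunit R n f) v

/-- A matrix is Toeplitz if its entries depend only on `i - j`. -/
def IsToeplitz {n : ℕ} (T : Matrix (Fin n) (Fin n) ℝ) : Prop :=
  ∀ i j i' j' : Fin n, (i : ℤ) - (j : ℤ) = (i' : ℤ) - (j' : ℤ) → T i j = T i' j'

/-- A matrix is Hankel if its entries depend only on `i + j`. -/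
def IsHankel {n : ℕ} (H : Matrix (Fin n) (Fin n) ℝ) : Prop :=
  ∀ i j i' j' : Fin n, (i : ℕ) + (j : ℕ) = (i' : ℕ) + (j' : ℕ) → H i j = H i' j'

/-- The DFT matrix `Ω_{jk} = ω^{jk}` (0-indexed) with `ω = exp(-2πi/n)`. -/
def dft (n : ℕ) : Matrix (Fin n) (Fin n) ℂ :=
  Matrix.of fun j k => Complex.exp (-2 * Real.pi * Complex.I / n) ^ ((j : ℕ) * (k : ℕ))

/-- The product of two Krylov matrices is a sum of powers of `A` and `B` applied to an outer
product. -/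
theorem krylov_mul_krylov_transpose {R : Type*} [CommRing R] {n : ℕ}
    (A B : Matrix (Fin n) (Fin n) R) (v w : Fin n → R) :
    krylov A v * (krylov Bᵀ w)ᵀ =
      ∑ k ∈ Finset.range n, A ^ k * Matrix.vecMulVec v w * B ^ k := by
  rw [Finset.sum_range]
  ext i j
  rw [Matrix.sum_apply, Matrix.mul_apply]
  refine Finset.sum_congr rfl fun k _ => ?_
  rw [Matrix.mul_vecMulVec, Matrix.vecMulVec_mul, Matrix.vecMulVec_apply, ← Matrix.mulVec_transpose,
    Matrix.transpose_pow]
  rfl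

/-- Summing the conjugates of the Stein displacement telescopes. -/
theorem sum_pow_mul_stein_mul_pow {S : Type*} [Ring S] (A B M : S) (n : ℕ) :
    ∑ k ∈ Finset.range n, A ^ k * (M - A * M * B) * B ^ k = M - A ^ n * M * B ^ n := by
  have hterm : ∀ k, A ^ k * (M - A * M * B) * B ^ k =
      A ^ k * M * B ^ k - A ^ (k + 1) * M * B ^ (k + 1) := fun k => by
    rw [pow_succ A, pow_succ' B]
    noncomm_ring
  simp only [hterm]
  rw [Finset.sum_range_sub']
  simp

theorem stein_krylov_decomposition {F : Type*} [Field F] {n : ℕ} (hn : 0 < n) (r : ℕ)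
    (A B M : Matrix (Fin n) (Fin n) F) (a b : F)
    (hA : A ^ n = a • (1 : Matrix (Fin n) (Fin n) F))
    (hB : B ^ n = b • (1 : Matrix (Fin n) (Fin n) F))
    (hab : a * b ≠ 1)
    (g h : Fin r → (Fin n → F))
    (hM : M - A * M * B = ∑ j : Fin r, Matrix.vecMulVec (g j) (h j)) :
    M = (1 - a * b)⁻¹ • ∑ j : Fin r, krylov A (g j) * (krylov Bᵀ (h j))ᵀ := by
  have hne : 1 - a * b ≠ 0 := sub_ne_zero.mpr hab.symm
  rw [eq_inv_smul_iff₀ hne]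
  simp only [krylov_mul_krylov_transpose]
  rw [Finset.sum_comm]
  simp only [← Finset.mul_sum, ← Finset.sum_mul]
  rw [← hM, sum_pow_mul_stein_mul_pow, hA, hB]
  simp [sub_smul, mul_smul, smul_comm a b]
end
end

section
/- Let n be a positive integer and M ∈ ℝ^{n×n}. If the Sylvester displacement Z_1·M − M·Z_{−1} equals Σ_{j=1}^{r} g_j·h_j^T for vectors g_1,…,g_r, h_1,…,h_r ∈ ℝ^n, then M = (1/2) · Σ_{j=1}^{r} Z_1(g_j) · Z_{−1}(J·h_j), where J is the reversal matrix. -/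
open Matrix BigOperators

noncomputable section

section Zunit

variable {R : Type*} [CommRing R] {n : ℕ} (f : R)

lemma Zunit_mulVec_succ (v : Fin n → R) {i : ℕ} (hi : i + 1 < n) :
    (Zunit R n f *ᵥ v) ⟨i + 1, hi⟩ = v ⟨i, by omega⟩ := by
  rw [Matrix.mulVec, dotProduct, Finset.sum_eq_single ⟨i, by omega⟩]
  · simp [Zunit]
  · intro b _ hb
    have : i ≠ (b : ℕ) := fun h => hb (Fin.ext h.symm)
    simp [Zunit, this]
  · simp

lemma Zunit_mulVec_zero (v : Fin n → R) (hn : 0 < n) :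
    (Zunit R n f *ᵥ v) ⟨0, hn⟩ = f * v ⟨n - 1, by omega⟩ := by
  rw [Matrix.mulVec, dotProduct, Finset.sum_eq_single ⟨n - 1, by omega⟩]
  · simp [Zunit]
  · intro b _ hb
    have : (b : ℕ) ≠ n - 1 := fun h => hb (Fin.ext h)
    simp [Zunit, this]
  · simp

/-- Powers of `Z_f` shift the entries above the last one into the last position. -/
lemma Zunit_pow_mulVec_last (v : Fin n → R) {k : ℕ} (hk : k < n) :
    ((Zunit R n f ^ k) *ᵥ v) ⟨n - 1, by omega⟩ = v ⟨n - 1 - k, by omega⟩ := by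
  induction k generalizing v with
  | zero => simp
  | succ k ih =>
    rw [pow_succ, ← Matrix.mulVec_mulVec, ih _ (by omega),
      ← Zunit_mulVec_succ f v (i := n - 1 - (k + 1)) (by omega)]
    congr 2
    omega

lemma Zunit_pow_mulVec_apply (v : Fin n → R) (i : Fin n) :
    v i = ((Zunit R n f ^ (n - 1 - (i : ℕ))) *ᵥ v) ⟨n - 1, by have := i.isLt; omega⟩ := by
  rw [Zunit_pow_mulVec_last f v (by omega)]
  congr 1
  ext
  simp only
  omega

lemma Zunit_pow_card : Zunit R n f ^ n = f • (1 : Matrix (Fin n) (Fin n) R) := by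
  refine Matrix.ext_iff_mulVec.mpr fun v => ?_
  ext i
  have hn : 0 < n := i.pos
  rw [Zunit_pow_mulVec_apply f ((Zunit R n f ^ n) *ᵥ v) i, Matrix.mulVec_mulVec, ← pow_add,
    show n - 1 - (i : ℕ) + n = (n - 1) + 1 + (n - 1 - (i : ℕ)) by omega, pow_add, pow_succ,
    ← Matrix.mulVec_mulVec, ← Matrix.mulVec_mulVec, Zunit_pow_mulVec_last f _ (by omega)]
  simp only [Nat.sub_self]
  rw [Zunit_mulVec_zero f _ hn, ← Zunit_pow_mulVec_apply f v i]
  simp [Matrix.smul_mulVec]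

lemma Zunit_rev_rev (i j : Fin n) : Zunit R n f i.rev j.rev = Zunit R n f j i := by
  have h₁ : (i.rev : ℕ) = (j.rev : ℕ) + 1 ↔ (j : ℕ) = (i : ℕ) + 1 := by
    simp only [Fin.val_rev]; omega
  have h₂ : (i.rev : ℕ) = 0 ∧ (j.rev : ℕ) = n - 1 ↔ (j : ℕ) = 0 ∧ (i : ℕ) = n - 1 := by
    simp only [Fin.val_rev]; omega
  simp only [Zunit, Matrix.of_apply, h₁, h₂]

lemma vecMul_Zunit_comp_rev (h : Fin n → R) :
    (h ᵥ* Zunit R n f) ∘ Fin.rev = Zunit R n f *ᵥ (h ∘ Fin.rev) := by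
  ext i
  simp only [Function.comp_apply, Matrix.vecMul, Matrix.mulVec, dotProduct]
  rw [← Equiv.sum_comp Fin.revPerm]
  exact Finset.sum_congr rfl fun j _ => by
    rw [Fin.revPerm_apply, Zunit_rev_rev, mul_comm]

lemma vecMul_Zunit_pow_comp_rev (h : Fin n → R) (k : ℕ) :
    (h ᵥ* Zunit R n f ^ k) ∘ Fin.rev = (Zunit R n f ^ k) *ᵥ (h ∘ Fin.rev) := by
  induction k with
  | zero => simp
  | succ k ih =>
    rw [pow_succ, ← Matrix.vecMul_vecMul, vecMul_Zunit_comp_rev, ih, Matrix.mulVec_mulVec,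
      ← pow_succ', pow_succ]

/-- The rows of `Z_f(Jh)` are the vectors `hᵀ Z_f ^ (n - 1 - i)`. -/
lemma Zcirc_comp_rev_apply (h : Fin n → R) (i k : Fin n) :
    Zcirc R n f (h ∘ Fin.rev) i k = (h ᵥ* Zunit R n f ^ (n - 1 - (i : ℕ))) k := by
  have hk := congrFun (vecMul_Zunit_pow_comp_rev f h (n - 1 - (i : ℕ))) k.rev
  rw [Function.comp_apply, Fin.rev_rev] at hk
  change ((Zunit R n f ^ (k : ℕ)) *ᵥ (h ∘ Fin.rev)) i = _
  rw [hk, Zunit_pow_mulVec_apply f ((Zunit R n f ^ (k : ℕ)) *ᵥ _) i,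
    Zunit_pow_mulVec_apply f ((Zunit R n f ^ (n - 1 - (i : ℕ))) *ᵥ _) k.rev,
    Matrix.mulVec_mulVec, Matrix.mulVec_mulVec, ← pow_add, ← pow_add]
  have hexp : n - 1 - (k.rev : ℕ) = k := by
    rw [Fin.val_rev]
    omega
  rw [hexp, add_comm]

lemma Zcirc_mul_Zcirc_comp_rev (e : R) (g h : Fin n → R) :
    Zcirc R n e g * Zcirc R n f (h ∘ Fin.rev) =
      ∑ k ∈ Finset.range n,
        Zunit R n e ^ k * Matrix.vecMulVec g h * Zunit R n f ^ (n - 1 - k) := by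
  ext i j
  rw [← Fin.sum_univ_eq_sum_range
    (fun k => Zunit R n e ^ k * Matrix.vecMulVec g h * Zunit R n f ^ (n - 1 - k)),
    Matrix.mul_apply, Matrix.sum_apply]
  refine Finset.sum_congr rfl fun k _ => ?_
  rw [Zcirc_comp_rev_apply, Matrix.mul_vecMulVec, Matrix.vecMulVec_mul, Matrix.vecMulVec_apply]
  rfl

end Zunit

/-- The telescoping sum obtained from the displacement `A * M - M * B`. -/
lemma sum_pow_mul_displacement_mul_pow {S : Type*} [Ring S] (A B M : S) (n : ℕ) :
    ∑ k ∈ Finset.range n, A ^ k * (A * M - M * B) * B ^ (n - 1 - k) =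
      A ^ n * M - M * B ^ n := by
  have h := Finset.sum_range_sub (fun k => A ^ k * M * B ^ (n - k)) n
  simp only [Nat.sub_self, pow_zero, mul_one, one_mul, Nat.sub_zero] at h
  rw [← h]
  refine Finset.sum_congr rfl fun k hk => ?_
  have hk := Finset.mem_range.mp hk
  rw [show n - k = n - 1 - k + 1 by omega, show n - (k + 1) = n - 1 - k by omega, pow_succ,
    pow_succ']
  noncomm_ring

lemma reversal_mulVec {R : Type*} [CommRing R] {n : ℕ} (v : Fin n → R) :
    (Matrix.of fun i j : Fin n => if (i : ℕ) + (j : ℕ) = n - 1 then (1 : R) else 0) *ᵥ v =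
      v ∘ Fin.rev := by
  ext i
  have h (j : Fin n) : (i : ℕ) + (j : ℕ) = n - 1 ↔ i.rev = j := by
    rw [Fin.ext_iff, Fin.val_rev]; omega
  simp [Matrix.mulVec, dotProduct, h]

theorem toeplitz_like_decomposition {n : ℕ} (hn : 0 < n) (r : ℕ)
    (M : Matrix (Fin n) (Fin n) ℝ) (g h : Fin r → (Fin n → ℝ))
    (J : Matrix (Fin n) (Fin n) ℝ)
    (hJ : J = Matrix.of fun i j : Fin n => if (i : ℕ) + (j : ℕ) = n - 1 then (1 : ℝ) else 0)
    (hM : Zunit ℝ n 1 * M - M * Zunit ℝ n (-1) = ∑ j : Fin r, Matrix.vecMulVec (g j) (h j)) :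
    M = (1 / 2 : ℝ) • ∑ j : Fin r, Zcirc ℝ n 1 (g j) * Zcirc ℝ n (-1) (J.mulVec (h j)) := by
  subst hJ
  have key := sum_pow_mul_displacement_mul_pow (Zunit ℝ n 1) (Zunit ℝ n (-1)) M n
  rw [hM, Zunit_pow_card, Zunit_pow_card] at key
  simp only [Finset.mul_sum, Finset.sum_mul] at key
  rw [Finset.sum_comm] at key
  simp only [reversal_mulVec, Zcirc_mul_Zcirc_comp_rev]
  rw [key]
  ext i j
  simp
  ring
end
end

section
/- For every v ∈ ℝ^n there exist vectors g, h ∈ ℝ^n such that the circulant matrix Z_1(v) equals Z_1(g)·Z_{−1}(h), and there exist vectors g', h' ∈ ℝ^n such that the skew-circulant matrix Z_{−1}(v) equals Z_1(g')·Z_{−1}(h'). In particular, all n×n circulant and skew-circulant matrices lie in the class {Σ_{i=1}^{r} Z_1(g_i)·Z_{−1}(h_i)} for r ≥ 1. -/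
open Matrix BigOperators

noncomputable section

theorem Zunit_mulVec_single {R : Type*} [CommRing R] {n : ℕ} (f : R) (j : ℕ) (hj : j + 1 < n) :
    (Zunit R n f).mulVec (Pi.single ⟨j, by omega⟩ 1) = Pi.single ⟨j + 1, hj⟩ 1 := by
  ext i
  have hne : ¬ ((i : ℕ) = 0 ∧ j = n - 1) := by omega
  simp [Zunit, Pi.single_apply, Fin.ext_iff, hne]

theorem Zunit_pow_mulVec_single_zero {R : Type*} [CommRing R] {n : ℕ} (f : R) (j : ℕ)
    (hj : j < n) :
    (Zunit R n f ^ j).mulVec (Pi.single ⟨0, by omega⟩ 1) = Pi.single ⟨j, hj⟩ 1 := by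
  induction j with
  | zero => rw [pow_zero, Matrix.one_mulVec]
  | succ k ih =>
    rw [pow_succ', ← Matrix.mulVec_mulVec, ih (by omega), Zunit_mulVec_single f k hj]

theorem Zcirc_single_zero {R : Type*} [CommRing R] {n : ℕ} (f : R) (hn : 0 < n) :
    Zcirc R n f (Pi.single ⟨0, hn⟩ 1) = 1 := by
  ext i j
  change (Zunit R n f ^ (j : ℕ)).mulVec (Pi.single ⟨0, hn⟩ 1) i = _
  rw [Zunit_pow_mulVec_single_zero f j j.isLt, Matrix.one_apply, Pi.single_apply]

theorem circulant_skewcirculant_in_class {n : ℕ} (v : Fin n → ℝ) :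
    (∃ g h : Fin n → ℝ, Zcirc ℝ n 1 v = Zcirc ℝ n 1 g * Zcirc ℝ n (-1) h) ∧
    (∃ g' h' : Fin n → ℝ, Zcirc ℝ n (-1) v = Zcirc ℝ n 1 g' * Zcirc ℝ n (-1) h') := by
  rcases Nat.eq_zero_or_pos n with rfl | hn
  · exact ⟨⟨v, v, Subsingleton.elim _ _⟩, ⟨v, v, Subsingleton.elim _ _⟩⟩
  · exact ⟨⟨v, Pi.single ⟨0, hn⟩ 1, by rw [Zcirc_single_zero, mul_one]⟩,
      ⟨Pi.single ⟨0, hn⟩ 1, v, by rw [Zcirc_single_zero, one_mul]⟩⟩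
end
end

section
/- For every n×n Toeplitz matrix T over ℝ there exist vectors g_1, g_2, h_1, h_2 ∈ ℝ^n such that T = Σ_{i=1}^{2} Z_1(g_i)·Z_{−1}(h_i). -/
open Matrix BigOperators

noncomputable section

theorem Zunit_mulVec {R : Type*} [CommRing R] {n : ℕ} (f : R) (v : Fin n → R) (i : Fin n) :
    (Zunit R n f).mulVec v i =
      if (i : ℕ) = 0 then f * v ⟨n - 1, Nat.sub_one_lt_of_lt i.isLt⟩ else v ⟨i - 1, by omega⟩ := by
  simp only [Matrix.mulVec, dotProduct, Zunit, Matrix.of_apply]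
  split_ifs with hi
  · rw [Finset.sum_eq_single_of_mem ⟨n - 1, Nat.sub_one_lt_of_lt i.isLt⟩ (Finset.mem_univ _)]
    · simp [hi]
    · intro k _ hk
      have hk' : (k : ℕ) ≠ n - 1 := fun h => hk (Fin.ext h)
      simp [hi, hk']
  · rw [Finset.sum_eq_single_of_mem ⟨i - 1, by omega⟩ (Finset.mem_univ _)]
    · rw [if_pos (by simp only; omega), one_mul]
    · intro k _ hk
      have hk' : (k : ℕ) ≠ i - 1 := fun h => hk (Fin.ext h)
      rw [if_neg (by omega), if_neg (by tauto), zero_mul]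

theorem Zunit_pow_mulVec {R : Type*} [CommRing R] {n : ℕ} (f : R) (w : ℕ → R) (k : ℕ)
    (hk : k ≤ n) (i : Fin n) :
    (Zunit R n f ^ k).mulVec (fun m : Fin n => w m) i =
      if k ≤ i then w (i - k) else f * w (i + n - k) := by
  induction k generalizing i with
  | zero => simp
  | succ k ih =>
    rw [pow_succ', ← Matrix.mulVec_mulVec, Zunit_mulVec, ih (by omega), ih (by omega)]
    have hi := i.isLt
    simp only
    by_cases h0 : (i : ℕ) = 0
    · rw [if_pos h0, if_pos (by omega), if_neg (by omega)]
      congr 2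
      omega
    · rw [if_neg h0]
      by_cases h1 : k + 1 ≤ i
      · rw [if_pos (by omega), if_pos h1]
        congr 1
        omega
      · rw [if_neg (by omega), if_neg h1]
        congr 2
        omega

theorem Zcirc_apply {R : Type*} [CommRing R] {n : ℕ} (f : R) (w : ℕ → R) (i j : Fin n) :
    Zcirc R n f (fun m => w m) i j =
      if (j : ℕ) ≤ i then w (i - j) else f * w (i + n - j) :=
  Zunit_pow_mulVec f w j j.isLt.le i

theorem Zcirc_single_zero_s5 {R : Type*} [CommRing R] {n : ℕ} (f : R) :
    Zcirc R n f (fun m => if (m : ℕ) = 0 then 1 else 0) = 1 := by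
  ext i j
  rw [Zcirc_apply f (fun m => if m = 0 then 1 else 0), Matrix.one_apply]
  simp only [Fin.ext_iff]
  split_ifs <;> first | omega | simp

theorem IsToeplitz.exists_diagonal {n : ℕ} {T : Matrix (Fin n) (Fin n) ℝ} (hT : IsToeplitz T) :
    ∃ t : ℤ → ℝ, ∀ i j : Fin n, T i j = t ((i : ℤ) - (j : ℤ)) := by
  have h : Function.FactorsThrough (fun p : Fin n × Fin n => T p.1 p.2)
      (fun p => (p.1 : ℤ) - (p.2 : ℤ)) := fun p q hpq => hT _ _ _ _ hpq
  exact ⟨Function.extend _ _ 0, fun i j => (h.extend_apply 0 (i, j)).symm⟩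

theorem toeplitz_in_class {n : ℕ} (T : Matrix (Fin n) (Fin n) ℝ)
    (hT : IsToeplitz T) :
    ∃ g h : Fin 2 → (Fin n → ℝ),
      T = ∑ i : Fin 2, Zcirc ℝ n 1 (g i) * Zcirc ℝ n (-1) (h i) := by
  obtain ⟨t, ht⟩ := hT.exists_diagonal
  let c : ℕ → ℝ := fun k => (t k + t (k - n)) / 2
  let s : ℕ → ℝ := fun k => (t k - t (k - n)) / 2
  let e : Fin n → ℝ := fun m => if (m : ℕ) = 0 then 1 else 0
  refine ⟨![fun m => c m, e], ![e, fun m => s m], ?_⟩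
  have he (f : ℝ) : Zcirc ℝ n f e = 1 := Zcirc_single_zero_s5 f
  simp only [Fin.sum_univ_two, Matrix.cons_val_zero, Matrix.cons_val_one, he, mul_one, one_mul]
  ext i j
  rw [Matrix.add_apply, Zcirc_apply, Zcirc_apply, ht]
  simp only [c, s]
  split_ifs with hij
  · rw [Nat.cast_sub hij]
    ring
  · rw [Nat.cast_sub (by omega), Nat.cast_add,
      show (i : ℤ) + n - j - n = (i : ℤ) - j by ring]
    ring
end
end

section
/- Let H be an n×n Hankel matrix over ℝ. Then rank(Z_1·H − H·Z_0^T) ≤ 2, where Z_0^T is the transpose of the 0-unit-circulant (the upper-shift matrix). -/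
open Matrix BigOperators

noncomputable section

theorem Matrix.rank_add_le {K m n : Type*} [Field K] [Finite m] [Fintype n]
    (A B : Matrix m n K) : (A + B).rank ≤ A.rank + B.rank := by
  refine (Submodule.finrank_mono ?_).trans (Submodule.finrank_add_le_finrank_add_finrank _ _)
  rintro _ ⟨x, rfl⟩
  rw [mulVecLin_add, LinearMap.add_apply]
  exact Submodule.add_mem_sup ⟨x, rfl⟩ ⟨x, rfl⟩

theorem Matrix.rank_le_two_of_succ_succ_eq_zero {K : Type*} [Field K] {m : ℕ}
    (M : Matrix (Fin (m + 1)) (Fin (m + 1)) K) (hM : ∀ i j : Fin m, M i.succ j.succ = 0) :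
    M.rank ≤ 2 := by
  have h : M = vecMulVec (Pi.single 0 1) (M 0) +
      vecMulVec (Fin.cons 0 fun i => M i.succ 0) (Pi.single 0 1) := by
    ext i j
    refine Fin.cases ?_ (fun i => ?_) i
    · simp [vecMulVec_apply]
    · refine Fin.cases ?_ (fun j => ?_) j <;> simp [vecMulVec_apply, hM]
  rw [h]
  exact (Matrix.rank_add_le _ _).trans (add_le_add (rank_vecMulVec_le _ _) (rank_vecMulVec_le _ _))

theorem Zunit_mul_apply_succ {R : Type*} [CommRing R] {m : ℕ} (f : R)
    (A : Matrix (Fin (m + 1)) (Fin (m + 1)) R) (i : Fin m) (j : Fin (m + 1)) :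
    (Zunit R (m + 1) f * A) i.succ j = A i.castSucc j := by
  rw [mul_apply, Finset.sum_eq_single i.castSucc]
  · simp [Zunit]
  · intro k _ hk
    have : (i : ℕ) ≠ k := fun h => hk (Fin.ext h.symm)
    simp [Zunit, this]
  · simp

theorem hankel_displacement_rank_le_two {n : ℕ} (H : Matrix (Fin n) (Fin n) ℝ)
    (hH : IsHankel H) :
    (Zunit ℝ n 1 * H - H * (Zunit ℝ n 0)ᵀ).rank ≤ 2 := by
  cases n with
  | zero => simp
  | succ m =>
    refine Matrix.rank_le_two_of_succ_succ_eq_zero _ fun i j => ?_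
    have h : (H * (Zunit ℝ (m + 1) 0)ᵀ) i.succ j.succ = H i.succ j.castSucc := by
      rw [← transpose_apply (H * _), transpose_mul, transpose_transpose,
        Zunit_mul_apply_succ, transpose_apply]
    rw [Matrix.sub_apply, Zunit_mul_apply_succ, h, sub_eq_zero]
    refine hH _ _ _ _ ?_
    simp only [Fin.val_succ, Fin.val_castSucc]
    omega
end
end

section
/- Let n ≥ 1, let w ∈ ℂ be nonzero, set f = w^n, let d = (1, w, w², …, w^{n−1}) ∈ ℂ^n and D = diag(d). Then for every v ∈ ℂ^n the f-circulant matrix diagonalizes as Z_f(v) = D^{-1} · Ω^{-1} · diag(Ω·(d ∘ v)) · Ω · D, where Ω is the n×n DFT matrix. -/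
open Matrix BigOperators

noncomputable section

/-- The geometric vector `(1, x, …, x^{n-1})` is a left eigenvector of `Z_f` when `x ^ n = f`. -/
theorem vecMul_Zunit {R : Type*} [CommRing R] {n : ℕ} {f x : R} (hx : x ^ n = f) :
    (fun i : Fin n => x ^ (i : ℕ)) ᵥ* Zunit R n f = x • fun i : Fin n => x ^ (i : ℕ) := by
  ext k
  have hk := k.isLt
  simp only [vecMul, dotProduct, Zunit, of_apply, Pi.smul_apply, smul_eq_mul, ← pow_succ']
  by_cases h : (k : ℕ) + 1 < n
  · rw [Finset.sum_eq_single ⟨k + 1, h⟩]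
    · simp
    · intro i _ hi
      have h₁ : (i : ℕ) ≠ k + 1 := fun e => hi (Fin.ext e)
      have h₂ : ¬((i : ℕ) = 0 ∧ (k : ℕ) = n - 1) := by omega
      simp [h₁, h₂]
    · simp
  · have hn : (k : ℕ) + 1 = n := by omega
    rw [Finset.sum_eq_single ⟨0, by omega⟩]
    · have h₂ : (k : ℕ) = n - 1 := by omega
      rw [if_neg (by simp), if_pos ⟨rfl, h₂⟩, hn, hx]
      simp
    · intro i _ hi
      have h₁ : (i : ℕ) ≠ k + 1 := by omega
      have h₂ : (i : ℕ) ≠ 0 := fun e => hi (Fin.ext e)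
      simp [h₁, h₂]
    · simp

theorem vecMul_Zunit_pow {R : Type*} [CommRing R] {n : ℕ} {f x : R} (hx : x ^ n = f) (m : ℕ) :
    (fun i : Fin n => x ^ (i : ℕ)) ᵥ* Zunit R n f ^ m =
      x ^ m • fun i : Fin n => x ^ (i : ℕ) := by
  induction m with
  | zero => simp
  | succ m ih =>
    rw [pow_succ, ← vecMul_vecMul, ih, smul_vecMul, vecMul_Zunit hx, smul_smul, pow_succ]

theorem vecMul_Zcirc {R : Type*} [CommRing R] {n : ℕ} {f x : R} (hx : x ^ n = f)
    (v : Fin n → R) :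
    (fun i : Fin n => x ^ (i : ℕ)) ᵥ* Zcirc R n f v =
      ((fun i : Fin n => x ^ (i : ℕ)) ⬝ᵥ v) • fun i : Fin n => x ^ (i : ℕ) := by
  ext k
  change (fun i : Fin n => x ^ (i : ℕ)) ⬝ᵥ (Zunit R n f ^ (k : ℕ)) *ᵥ v = _
  rw [dotProduct_mulVec, vecMul_Zunit_pow hx, smul_dotProduct, Pi.smul_apply, smul_eq_mul,
    smul_eq_mul, mul_comm]

theorem isPrimitiveRoot_dft {n : ℕ} (hn : n ≠ 0) :
    IsPrimitiveRoot (Complex.exp (-2 * Real.pi * Complex.I / n)) n := by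
  have h : Complex.exp (-2 * Real.pi * Complex.I / n) =
      (Complex.exp (2 * Real.pi * Complex.I / n))⁻¹ := by
    rw [← Complex.exp_neg]
    congr 1
    ring
  rw [h]
  exact (Complex.isPrimitiveRoot_exp n hn).inv

theorem isUnit_det_dft {n : ℕ} (hn : n ≠ 0) : IsUnit (dft n).det := by
  have h : dft n = vandermonde fun j : Fin n =>
      Complex.exp (-2 * Real.pi * Complex.I / n) ^ (j : ℕ) := by
    ext j k
    simp only [dft, of_apply, vandermonde_apply, pow_mul]
  rw [h, isUnit_iff_ne_zero, det_vandermonde_ne_zero_iff]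
  intro i j hij
  exact Fin.ext ((isPrimitiveRoot_dft hn).pow_inj i.isLt j.isLt hij)

/-- The rows of `Ω D` are the geometric vectors with ratios `ω ^ j * w`. -/
theorem dft_mul_diagonal_apply {n : ℕ} (w : ℂ) (j k : Fin n) :
    (dft n * diagonal fun i : Fin n => w ^ (i : ℕ)) j k =
      (Complex.exp (-2 * Real.pi * Complex.I / n) ^ (j : ℕ) * w) ^ (k : ℕ) := by
  rw [mul_diagonal, mul_pow, ← pow_mul, dft, of_apply]

theorem dft_mul_diagonal_mul_Zcirc {n : ℕ} (hn : n ≠ 0) (w : ℂ) (v : Fin n → ℂ) :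
    (dft n * diagonal fun i : Fin n => w ^ (i : ℕ)) * Zcirc ℂ n (w ^ n) v =
      diagonal (dft n *ᵥ fun i : Fin n => w ^ (i : ℕ) * v i) *
        (dft n * diagonal fun i : Fin n => w ^ (i : ℕ)) := by
  ext j k
  have hx : (Complex.exp (-2 * Real.pi * Complex.I / n) ^ (j : ℕ) * w) ^ n = w ^ n := by
    rw [mul_pow, pow_right_comm, (isPrimitiveRoot_dft hn).pow_eq_one, one_pow, one_mul]
  have hv : (dft n *ᵥ fun i : Fin n => w ^ (i : ℕ) * v i) =
      (dft n * diagonal fun i : Fin n => w ^ (i : ℕ)) *ᵥ v := by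
    rw [← mulVec_mulVec]
    congr 1
    ext i
    rw [mulVec_diagonal]
  rw [hv, diagonal_mul, mul_apply]
  simp only [mulVec, dotProduct, dft_mul_diagonal_apply]
  exact congrFun (vecMul_Zcirc hx v) k

theorem fcirculant_diagonalization {n : ℕ} (hn : 1 ≤ n) (w : ℂ) (hw : w ≠ 0)
    (f : ℂ) (hf : f = w ^ n) (v : Fin n → ℂ) :
    Zcirc ℂ n f v =
      (Matrix.diagonal fun i : Fin n => w ^ (i : ℕ))⁻¹ * (dft n)⁻¹ *
        Matrix.diagonal ((dft n).mulVec fun i : Fin n => w ^ (i : ℕ) * v i) *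
        dft n * Matrix.diagonal (fun i : Fin n => w ^ (i : ℕ)) := by
  subst hf
  have hn' : n ≠ 0 := Nat.one_le_iff_ne_zero.mp hn
  have hD : IsUnit (diagonal fun i : Fin n => w ^ (i : ℕ)).det := by
    rw [det_diagonal, isUnit_iff_ne_zero]
    exact Finset.prod_ne_zero_iff.mpr fun i _ => pow_ne_zero _ hw
  have hW : IsUnit (dft n * diagonal fun i : Fin n => w ^ (i : ℕ)).det := by
    rw [det_mul]
    exact (isUnit_det_dft hn').mul hD
  rw [← Matrix.mul_inv_rev, Matrix.mul_assoc, Matrix.mul_assoc,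
    ← dft_mul_diagonal_mul_Zcirc hn', nonsing_inv_mul_cancel_left _ _ hW]
end
end

section
/- Let n ≥ 1, let η = exp(iπ/n) be a primitive 2n-th root of unity, and let η⃗ = (1, η, η², …, η^{n−1}) ∈ ℂ^n. Then for all vectors v, x ∈ ℂ^n the skew-circulant matrix-vector product satisfies Z_{−1}(v)·x = conj(η⃗) ∘ Ω^{-1}·((Ω·(η⃗ ∘ v)) ∘ (Ω·(η⃗ ∘ x))), where conj(η⃗) is the entrywise complex conjugate of η⃗. -/
open Matrix BigOperators

noncomputable section

/-- If `ζ ^ n = f`, then `(1, ζ, …, ζ ^ (n - 1))` is a left eigenvector of `Z_f` for `ζ`. -/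
theorem pow_vecMul_Zunit {R : Type*} [CommRing R] {n : ℕ} {f ζ : R} (hζ : ζ ^ n = f) :
    (fun i : Fin n => ζ ^ (i : ℕ)) ᵥ* Zunit R n f = ζ • fun i : Fin n => ζ ^ (i : ℕ) := by
  ext j
  have hj := j.isLt
  simp only [vecMul, dotProduct, Zunit, of_apply, Pi.smul_apply, smul_eq_mul]
  by_cases h : (j : ℕ) + 1 < n
  · rw [Finset.sum_eq_single ⟨j + 1, h⟩]
    · simp [pow_succ']
    · intro i _ hi
      have h₁ : (i : ℕ) ≠ j + 1 := fun h' => hi (Fin.ext h')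
      have h₂ : ¬((i : ℕ) = 0 ∧ (j : ℕ) = n - 1) := by omega
      simp [h₁, h₂]
    · simp
  · have hn : n = (j : ℕ) + 1 := by omega
    rw [Finset.sum_eq_single ⟨0, by omega⟩]
    · have h₂ : (j : ℕ) = n - 1 := by omega
      rw [if_neg (by simp), if_pos ⟨rfl, h₂⟩, ← pow_succ', ← hn, hζ]
      simp
    · intro i _ hi
      have h₁ : (i : ℕ) ≠ j + 1 := by omega
      have h₂ : ¬((i : ℕ) = 0 ∧ (j : ℕ) = n - 1) := fun h' => hi (Fin.ext h'.1)
      simp [h₁, h₂]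
    · simp

/-- Powers of a matrix act on a left eigenvector by powers of the eigenvalue. -/
theorem vecMul_pow_of_vecMul_eq_smul {R ι : Type*} [CommRing R] [Fintype ι] [DecidableEq ι]
    {A : Matrix ι ι R} {p : ι → R} {c : R} (h : p ᵥ* A = c • p) (k : ℕ) :
    p ᵥ* A ^ k = c ^ k • p := by
  induction k with
  | zero => simp
  | succ k ih => rw [pow_succ, ← vecMul_vecMul, ih, smul_vecMul, h, smul_smul, pow_succ]

/-- Evaluation at an `n`-th root `ζ` of `f` turns the `f`-circulant product into
multiplication. -/
theorem pow_dotProduct_Zcirc_mulVec {R : Type*} [CommRing R] {n : ℕ} {f ζ : R}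
    (hζ : ζ ^ n = f) (v x : Fin n → R) :
    (fun i : Fin n => ζ ^ (i : ℕ)) ⬝ᵥ (Zcirc R n f v *ᵥ x)
      = ((fun i : Fin n => ζ ^ (i : ℕ)) ⬝ᵥ v) * ((fun i : Fin n => ζ ^ (i : ℕ)) ⬝ᵥ x) := by
  have key : (fun i : Fin n => ζ ^ (i : ℕ)) ᵥ* Zcirc R n f v
      = ((fun i : Fin n => ζ ^ (i : ℕ)) ⬝ᵥ v) • fun i : Fin n => ζ ^ (i : ℕ) := by
    ext j
    change (fun i : Fin n => ζ ^ (i : ℕ)) ⬝ᵥ (Zunit R n f ^ (j : ℕ) *ᵥ v) = _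
    rw [dotProduct_mulVec, vecMul_pow_of_vecMul_eq_smul (pow_vecMul_Zunit hζ), smul_dotProduct]
    simp [mul_comm]
  rw [dotProduct_mulVec, key, smul_dotProduct, smul_eq_mul]

/-- The `k`-th entry of the DFT of a vector scaled by powers of `c` is evaluation at `ω ^ k * c`. -/
theorem dft_mulVec_pow_mul {n : ℕ} (c : ℂ) (u : Fin n → ℂ) (k : Fin n) :
    (dft n *ᵥ fun i : Fin n => c ^ (i : ℕ) * u i) k
      = (fun i : Fin n =>
          (Complex.exp (-2 * Real.pi * Complex.I / n) ^ (k : ℕ) * c) ^ (i : ℕ)) ⬝ᵥ u := by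
  simp only [mulVec, dotProduct, dft, of_apply, mul_pow, pow_mul, mul_assoc]

theorem skewcirculant_mulVec_fft {n : ℕ} (hn : 1 ≤ n) (v x : Fin n → ℂ) :
    (Zcirc ℂ n (-1) v).mulVec x
      = (fun i : Fin n => (starRingEnd ℂ) (Complex.exp (Real.pi * Complex.I / n) ^ (i : ℕ)))
          * (dft n)⁻¹.mulVec
            (((dft n).mulVec fun i : Fin n => Complex.exp (Real.pi * Complex.I / n) ^ (i : ℕ) * v i)
              * ((dft n).mulVec fun i : Fin n =>
                  Complex.exp (Real.pi * Complex.I / n) ^ (i : ℕ) * x i)) := by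
  have hn' : n ≠ 0 := by omega
  have hnC : (n : ℂ) ≠ 0 := Nat.cast_ne_zero.mpr hn'
  set η := Complex.exp (Real.pi * Complex.I / n) with hη
  have hηn : η ^ n = -1 := by
    rw [hη, ← Complex.exp_nat_mul, mul_div_cancel₀ _ hnC, Complex.exp_pi_mul_I]
  have hωn : Complex.exp (-2 * Real.pi * Complex.I / n) ^ n = 1 := by
    rw [← Complex.exp_nat_mul, mul_div_cancel₀ _ hnC, neg_mul, neg_mul, Complex.exp_neg,
      Complex.exp_two_pi_mul_I, inv_one]
  have hconj : (starRingEnd ℂ) η * η = 1 := by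
    rw [hη, ← Complex.exp_conj, ← Complex.exp_add]
    simp [neg_div]
  have hdft : dft n *ᵥ (fun i : Fin n => η ^ (i : ℕ) * (Zcirc ℂ n (-1) v *ᵥ x) i)
      = (dft n *ᵥ fun i : Fin n => η ^ (i : ℕ) * v i)
        * (dft n *ᵥ fun i : Fin n => η ^ (i : ℕ) * x i) := by
    ext k
    rw [Pi.mul_apply]
    simp only [dft_mulVec_pow_mul]
    apply pow_dotProduct_Zcirc_mulVec
    rw [mul_pow, ← pow_mul, mul_comm (k : ℕ), pow_mul, hωn, one_pow, one_mul, hηn]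
  rw [← hdft, mulVec_mulVec, nonsing_inv_mul _ (isUnit_det_dft hn'), one_mulVec]
  ext i
  rw [Pi.mul_apply, map_pow, ← mul_assoc, ← mul_pow, hconj, one_pow, one_mul]
end
end
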